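/- For all i, j ∈ I and every integer d ≥ 1: ℰ'(e_i(0), e_j(d)) = ⟨Φ^{-1} β(e_j(d)), β(e_i(0))⟩, where Φ^{-1} plays the role of the inverse Coxeter transformation c^{-1}. -/

import Mathlib

namespace GQV

open Matrix

/-- Degree shift `η[d]`, i.e. `η[d]ᵢ(a) = ηᵢ(a + d)`. -/
noncomputable def shift {n : ℕ} (η : Fin n × ℝ → ℤ) (d : ℝ) : Fin n × ℝ → ℤ :=
  fun p => η (p.1, p.2 + d)

/-- The q-Cartan operator `C_q`. -/
noncomputable def Cq {n : ℕ} (b : Matrix (Fin n) (Fin n) ℤ) (η : Fin n × ℝ → ℤ) : Fin n × ℝ → ℤ :=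
  fun p =>
    η (p.1, p.2 + 1 / 2) + η (p.1, p.2 - 1 / 2)
      - ∑ i : Fin n, (if i < p.1 then b i p.1 * η (i, p.2 + 1 / 2) else 0)
      - ∑ j : Fin n, (if p.1 < j then b p.1 j * η (j, p.2 - 1 / 2) else 0)

/-- The pairing `η¹ · η² = Σ_{(i,a)} η¹ᵢ(a) η²ᵢ(a)`. -/
noncomputable def dotP {n : ℕ} (η₁ η₂ : Fin n × ℝ → ℤ) : ℤ := ∑ᶠ p, η₁ p * η₂ p

/-- The indicator function `e_{k,a}` of `(k,a)`. -/
noncomputable def eind {n : ℕ} (k : Fin n) (a : ℝ) : Fin n × ℝ → ℤ := fun p => if p = (k, a) then 1 else 0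

/-- Support contained in `I × ℤ`. -/
def SuppInt {n : ℕ} (η : Fin n × ℝ → ℤ) : Prop := ∀ p, η p ≠ 0 → ∃ m : ℤ, p.2 = (m : ℝ)

/-- Support contained in `I × (ℤ + 1/2)`. -/
def SuppHalfInt {n : ℕ} (η : Fin n × ℝ → ℤ) : Prop :=
  ∀ p, η p ≠ 0 → ∃ m : ℤ, p.2 = (m : ℝ) + 1 / 2

/-- The set `E`: functions supported on integer arguments, vanishing for all
sufficiently small arguments. -/
def memE {n : ℕ} (η : Fin n × ℝ → ℤ) : Prop :=
  SuppInt η ∧ ∃ N : ℤ, ∀ (k : Fin n) (a : ℝ), a < (N : ℝ) → η (k, a) = 0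

/-- The set `E[d] = {η[d] : η ∈ E}`. -/
def memEshift {n : ℕ} (d : ℝ) (η : Fin n × ℝ → ℤ) : Prop :=
  ∃ θ, memE θ ∧ η = shift θ d

/-- Functions on `I × (ℤ + 1/2)` vanishing for all sufficiently small arguments;
this is the set `E[1/2] = E[-1/2]`. -/
def memEhalf {n : ℕ} (η : Fin n × ℝ → ℤ) : Prop :=
  SuppHalfInt η ∧ ∃ N : ℤ, ∀ (k : Fin n) (a : ℝ), a < (N : ℝ) → η (k, a) = 0

/-- The strictly upper triangular part `b^>`. -/
def bUpper {n : ℕ} (b : Matrix (Fin n) (Fin n) ℤ) : Matrix (Fin n) (Fin n) ℤ :=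
  Matrix.of fun i j => if i < j then b i j else 0

/-- `E_Q = 1 - b^>`, the matrix of the Euler form. -/
def EQmat {n : ℕ} (b : Matrix (Fin n) (Fin n) ℤ) : Matrix (Fin n) (Fin n) ℤ := 1 - bUpper b

/-- The Euler form `⟨x, y⟩ = xᵀ E_Q y`. -/
def euler {n : ℕ} (b : Matrix (Fin n) (Fin n) ℤ) (x y : Fin n → ℤ) : ℤ :=
  x ⬝ᵥ (EQmat b *ᵥ y)

/-- The class `[Ī_i] = E_Q⁻¹ e_i` of the indecomposable injective with socle `S_i`. -/
noncomputable def Iinj {n : ℕ} (b : Matrix (Fin n) (Fin n) ℤ) (i : Fin n) : Fin n → ℤ :=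
  (EQmat b)⁻¹ *ᵥ Pi.single i 1

/-- The class `[P̄_i] = E_Q⁻ᵀ e_i` of the indecomposable projective with top `S_i`. -/
noncomputable def Pproj {n : ℕ} (b : Matrix (Fin n) (Fin n) ℤ) (i : Fin n) : Fin n → ℤ :=
  ((EQmat b)ᵀ)⁻¹ *ᵥ Pi.single i 1

/-- The Coxeter matrix `Φ = -E_Q⁻¹ E_Qᵀ`. -/
noncomputable def Cox {n : ℕ} (b : Matrix (Fin n) (Fin n) ℤ) : Matrix (Fin n) (Fin n) ℤ :=
  -((EQmat b)⁻¹ * (EQmat b)ᵀ)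

/-- The map `β`, defined `ℤ`-linearly by `β(e_{i,a}) = -Φ^a [Ī_i]` for `a ∈ ℤ`. -/
noncomputable def betaMap {n : ℕ} (b : Matrix (Fin n) (Fin n) ℤ) (η : Fin n × ℝ → ℤ) :
    Fin n → ℤ :=
  ∑ᶠ p : Fin n × ℤ, η (p.1, (p.2 : ℝ)) • ((-(Cox b ^ p.2)) *ᵥ Iinj b p.1)

/-- `𝒩(w¹,w²) = w¹[1/2]·C_q⁻¹w² − w¹[−1/2]·C_q⁻¹w² − w²[1/2]·C_q⁻¹w¹ + w²[−1/2]·C_q⁻¹w¹`,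
where `u₁ = C_q⁻¹ w¹`, `u₂ = C_q⁻¹ w²` are given as arguments. -/
noncomputable def Ncal {n : ℕ} (w₁ w₂ u₁ u₂ : Fin n × ℝ → ℤ) : ℤ :=
  dotP (shift w₁ (1 / 2)) u₂ - dotP (shift w₁ (-(1 / 2))) u₂
    - dotP (shift w₂ (1 / 2)) u₁ + dotP (shift w₂ (-(1 / 2))) u₁

/-- `ℰ'(w¹,w²) = −w¹[1/2]·C_q⁻¹w² + w²[1/2]·C_q⁻¹w¹`, where `u₁ = C_q⁻¹ w¹`,
`u₂ = C_q⁻¹ w²` are given as arguments. -/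
noncomputable def Ecal {n : ℕ} (w₁ w₂ u₁ u₂ : Fin n × ℝ → ℤ) : ℤ :=
  -dotP (shift w₁ (1 / 2)) u₂ + dotP (shift w₂ (1 / 2)) u₁

/-- The B-matrix of the level-1 ice quiver with z-pattern attached to `Q`. -/
def Btilde {n : ℕ} (b : Matrix (Fin n) (Fin n) ℤ) : Matrix (Fin n ⊕ Fin n) (Fin n) ℤ :=
  Matrix.of (Sum.elim (fun i k => b i k)
    (fun j k => -(if j = k then 1 else 0) + (if k < j then b k j else 0)))

/-- The index map: the `ℤ`-linear map on functions supported on `I × {-1, 0}`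
with `ind(e_{k,0}) = e_k` and `ind(e_{k,-1}) = e_{n+k} - e_k`. -/
noncomputable def indMap {n : ℕ} (w : Fin n × ℝ → ℤ) : Fin n ⊕ Fin n → ℤ :=
  Sum.elim (fun k => w (k, 0) - w (k, -1)) (fun k => w (k, -1))

end GQV


open Matrix GQV

theorem EQ_det {n : ℕ} (b : Matrix (Fin n) (Fin n) ℤ) : (EQmat b).det = 1 := by
  have h : (EQmat b).BlockTriangular id := by
    intro i j hij
    simp only [id] at hij
    simp [EQmat, bUpper, Matrix.one_apply, hij.ne', not_lt.mpr hij.le]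
  rw [Matrix.det_of_upperTriangular h]
  simp [EQmat, bUpper]

theorem Cq_vec {n : ℕ} (b : Matrix (Fin n) (Fin n) ℤ) (u : Fin n × ℝ → ℤ) (a : ℤ) :
    (EQmat b)ᵀ *ᵥ (fun k => u (k, (a : ℝ) + 1 / 2))
      + EQmat b *ᵥ (fun k => u (k, ((a - 1 : ℤ) : ℝ) + 1 / 2))
      = fun k => Cq b u (k, (a : ℝ)) := by
  have e : ((a - 1 : ℤ) : ℝ) + 1 / 2 = (a : ℝ) - 1 / 2 := by push_cast; ring
  rw [e]
  funext k
  have h1 : ((EQmat b)ᵀ *ᵥ (fun k => u (k, (a : ℝ) + 1 / 2))) k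
      = u (k, (a : ℝ) + 1 / 2)
        - ∑ i : Fin n, (if i < k then b i k * u (i, (a : ℝ) + 1 / 2) else 0) := by
    simp only [EQmat, Matrix.transpose_sub, Matrix.transpose_one, Matrix.sub_mulVec,
      Matrix.one_mulVec, Pi.sub_apply]
    simp [Matrix.mulVec, dotProduct, bUpper, ite_mul]
  have h2 : (EQmat b *ᵥ (fun k => u (k, (a : ℝ) - 1 / 2))) k
      = u (k, (a : ℝ) - 1 / 2)
        - ∑ i : Fin n, (if k < i then b k i * u (i, (a : ℝ) - 1 / 2) else 0) := by
    simp only [EQmat, Matrix.sub_mulVec, Matrix.one_mulVec, Pi.sub_apply]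
    simp [Matrix.mulVec, dotProduct, bUpper, ite_mul]
  rw [Pi.add_apply, h1, h2]
  simp only [Cq]
  ring

theorem vec_rec {n : ℕ} (b : Matrix (Fin n) (Fin n) ℤ) (x y w : Fin n → ℤ)
    (h : (EQmat b)ᵀ *ᵥ x + EQmat b *ᵥ y = w) :
    x = (EQmat b)ᵀ⁻¹ *ᵥ w + (-((EQmat b)ᵀ⁻¹ * EQmat b)) *ᵥ y := by
  have hu : IsUnit (EQmat b)ᵀ.det := by rw [Matrix.det_transpose, EQ_det]; exact isUnit_one
  rw [← h, Matrix.mulVec_add, Matrix.mulVec_mulVec, Matrix.nonsing_inv_mul _ hu,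
    Matrix.one_mulVec, Matrix.neg_mulVec, Matrix.mulVec_mulVec]
  abel

theorem vanish {n : ℕ} (b : Matrix (Fin n) (Fin n) ℤ) (u : Fin n × ℝ → ℤ) (hu : memEhalf u)
    (j : Fin n) (d : ℤ) (hC : Cq b u = eind j (d : ℝ)) (a : ℤ) (ha : a < d) :
    (fun k => u (k, (a : ℝ) + 1 / 2)) = 0 := by
  obtain ⟨-, N, hN⟩ := hu
  have key : ∀ m : ℕ, ∀ a : ℤ, a < d → a < N + m →
      (fun k => u (k, (a : ℝ) + 1 / 2)) = 0 := by
    intro m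
    induction m with
    | zero =>
      intro a _ h
      funext k
      apply hN
      have : ((a + 1 : ℤ) : ℝ) ≤ N := by exact_mod_cast (by simpa using h : a < N)
      push_cast at this
      linarith
    | succ m ih =>
      intro a had h
      have h0 := ih (a - 1) (by omega) (by push_cast at h; omega)
      have h1 := vec_rec b _ _ _ (Cq_vec b u a)
      rw [h0, hC] at h1
      rw [h1]
      have : (fun k => eind j (d : ℝ) (k, (a : ℝ))) = (0 : Fin n → ℤ) := by
        funext k
        simp [eind, had.ne]
      rw [this]
      simp
  exact key (a - N + 1).toNat a ha (by omega)

theorem u_formula {n : ℕ} (b : Matrix (Fin n) (Fin n) ℤ) (u : Fin n × ℝ → ℤ) (hu : memEhalf u)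
    (i : Fin n) (hC : Cq b u = eind i (0 : ℝ)) (m : ℕ) :
    (fun k => u (k, ((m : ℤ) : ℝ) + 1 / 2))
      = (-((EQmat b)ᵀ⁻¹ * EQmat b)) ^ m *ᵥ ((EQmat b)ᵀ⁻¹ *ᵥ Pi.single i 1) := by
  induction m with
  | zero =>
    have h1 := vec_rec b _ _ _ (Cq_vec b u ((0 : ℕ) : ℤ))
    rw [vanish b u hu i 0 (by simpa using hC) (((0 : ℕ) : ℤ) - 1) (by simp), hC] at h1
    rw [h1]
    have : (fun k => eind i (0 : ℝ) (k, (((0 : ℕ) : ℤ) : ℝ))) = (Pi.single i 1 : Fin n → ℤ) := by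
      funext k
      simp [eind, Pi.single_apply]
    rw [this]
    simp
  | succ m ih =>
    have h1 := vec_rec b _ _ _ (Cq_vec b u ((m + 1 : ℕ) : ℤ))
    have e : (((m + 1 : ℕ) : ℤ) - 1) = (m : ℤ) := by push_cast; ring
    rw [e, ih, hC] at h1
    rw [h1]
    have : (fun k => eind i (0 : ℝ) (k, (((m + 1 : ℕ) : ℤ) : ℝ))) = (0 : Fin n → ℤ) := by
      funext k
      have : (m : ℝ) + 1 ≠ 0 := by positivity
      simp [eind, this]
    rw [this, pow_succ', Matrix.mulVec_zero, zero_add, Matrix.mulVec_mulVec]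

theorem dotP_shift {n : ℕ} (u : Fin n × ℝ → ℤ) (i : Fin n) (a : ℝ) :
    dotP (shift (eind i a) (1 / 2)) u = u (i, a - 1 / 2) := by
  unfold dotP
  rw [finsum_eq_single _ (i, a - 1 / 2)]
  · simp [shift, eind]
  · rintro ⟨k, c⟩ h
    have : ¬ (k = i ∧ c + 1 / 2 = a) := by
      rintro ⟨rfl, rfl⟩
      exact h (by simp)
    simp only [shift, eind, Prod.mk.injEq, if_neg this, zero_mul]

theorem beta_eind {n : ℕ} (b : Matrix (Fin n) (Fin n) ℤ) (i : Fin n) (d : ℤ) :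
    betaMap b (eind i (d : ℝ)) = (-(Cox b ^ d)) *ᵥ Iinj b i := by
  unfold betaMap
  rw [finsum_eq_single _ (i, d)]
  · simp [eind]
  · rintro ⟨k, c⟩ h
    have : ¬ (k = i ∧ c = d) := by
      rintro ⟨rfl, rfl⟩
      exact h rfl
    simp [eind, this]

theorem Cox_det {n : ℕ} (b : Matrix (Fin n) (Fin n) ℤ) : IsUnit (Cox b).det := by
  have h : IsUnit (EQmat b).det := by rw [EQ_det]; exact isUnit_one
  have ht : IsUnit (EQmat b)ᵀ.det := by rw [Matrix.det_transpose]; exact h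
  unfold Cox
  rw [← Matrix.isUnit_iff_isUnit_det, IsUnit.neg_iff]
  exact ((Matrix.isUnit_nonsing_inv_iff).2 ((Matrix.isUnit_iff_isUnit_det _).2 h)).mul
    ((Matrix.isUnit_iff_isUnit_det _).2 ht)

theorem pow_comm {n : ℕ} (b : Matrix (Fin n) (Fin n) ℤ) (m : ℕ) :
    (Cox b ^ m * (EQmat b)⁻¹)ᵀ = (-((EQmat b)ᵀ⁻¹ * EQmat b)) ^ m * (EQmat b)ᵀ⁻¹ := by
  have h : SemiconjBy ((EQmat b)ᵀ⁻¹) (Cox b)ᵀ (-((EQmat b)ᵀ⁻¹ * EQmat b)) := by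
    simp [SemiconjBy, Cox, Matrix.transpose_nonsing_inv, mul_assoc]
  rw [Matrix.transpose_mul, Matrix.transpose_pow, Matrix.transpose_nonsing_inv]
  exact h.pow_right m

/-- for `d ≥ 1`, `ℰ'(e_i(0), e_j(d)) = ⟨Φ⁻¹ β(e_j(d)), β(e_i(0))⟩`.
Here `u₁ = C_q⁻¹ e_i(0)` and `u₂ = C_q⁻¹ e_j(d)`. -/
theorem Ecal_eq_euler_coxeter (n : ℕ) (hn : 0 < n) (b : Matrix (Fin n) (Fin n) ℤ)
    (hskew : bᵀ = -b) (hsign : ∀ i j : Fin n, i < j → 0 ≤ b i j)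
    (i j : Fin n) (d : ℤ) (hd : 1 ≤ d) (u₁ u₂ : Fin n × ℝ → ℤ)
    (hu₁ : GQV.memEhalf u₁) (hu₂ : GQV.memEhalf u₂)
    (hu₁Cq : GQV.Cq b u₁ = GQV.eind i (0 : ℝ))
    (hu₂Cq : GQV.Cq b u₂ = GQV.eind j (d : ℝ)) :
    GQV.Ecal (GQV.eind i (0 : ℝ)) (GQV.eind j (d : ℝ)) u₁ u₂
      = GQV.euler b ((GQV.Cox b)⁻¹ *ᵥ GQV.betaMap b (GQV.eind j (d : ℝ)))
          (GQV.betaMap b (GQV.eind i (0 : ℝ))) := by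
  obtain ⟨m, rfl⟩ : ∃ m : ℕ, d = (m : ℤ) + 1 := ⟨(d - 1).toNat, by omega⟩
  have hE : IsUnit (EQmat b).det := by rw [EQ_det]; exact isUnit_one
  have hv := congrFun (vanish b u₂ hu₂ j _ hu₂Cq (-1) (by omega)) i
  have hf := congrFun (u_formula b u₁ hu₁ i hu₁Cq m) j
  have e1 : (0 : ℝ) - 1 / 2 = ((-1 : ℤ) : ℝ) + 1 / 2 := by push_cast; norm_num
  have e2 : (((m : ℤ) + 1 : ℤ) : ℝ) - 1 / 2 = ((m : ℤ) : ℝ) + 1 / 2 := by push_cast; ring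
  have b0 := beta_eind b i 0
  rw [Int.cast_zero, zpow_zero] at b0
  unfold Ecal
  rw [dotP_shift, dotP_shift, e1, e2]
  simp only [Pi.zero_apply] at hv
  rw [hv, hf, b0, beta_eind]
  unfold euler Iinj
  have e3 : (Cox b)⁻¹ * Cox b ^ ((m : ℤ) + 1) = Cox b ^ m := by
    rw [add_comm, Matrix.zpow_one_add (Cox_det b), ← mul_assoc,
      Matrix.nonsing_inv_mul _ (Cox_det b), one_mul, zpow_natCast]
  have e4 : EQmat b *ᵥ ((-1 : Matrix (Fin n) (Fin n) ℤ) *ᵥ ((EQmat b)⁻¹ *ᵥ Pi.single i 1))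
      = -(Pi.single i 1) := by
    rw [Matrix.neg_mulVec, Matrix.one_mulVec, Matrix.mulVec_neg, Matrix.mulVec_mulVec,
      Matrix.mul_nonsing_inv _ hE, Matrix.one_mulVec]
  have e5 : (Cox b)⁻¹ *ᵥ ((-(Cox b ^ ((m : ℤ) + 1))) *ᵥ ((EQmat b)⁻¹ *ᵥ Pi.single j 1))
      = -((Cox b ^ m * (EQmat b)⁻¹) *ᵥ Pi.single j 1) := by
    rw [Matrix.neg_mulVec, Matrix.mulVec_neg, Matrix.mulVec_mulVec, e3, Matrix.mulVec_mulVec]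
  rw [e4, e5, Matrix.mulVec_mulVec, ← pow_comm]
  simp [-Matrix.transpose_mul]
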